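/- Let X and Y be finite types, O a finite type with maps r_X : O → (X → ℤˣ), r_Y : O → (Y → ℤˣ) and σ : O → ℤˣ. Suppose O carries an involution o ↦ ō satisfying r_X(ō) = −r_X(o) and r_Y(ō) = −r_Y(o) (pointwise negation), and suppose χ ∈ ℤ satisfies χ + |X| + |Y| ≡ 0 (mod 2) and σ(ō) = (−1)^{(χ − |X| + |Y|)/2}·σ(o) for all o ∈ O. Then the map F_{(O,σ,r_X,r_Y)} : 𝕆(X) → 𝕆(Y) is homogeneous of degree χ with respect to the mod-4 gradings: F(𝕆_k(X)) ⊆ 𝕆_{k + χ}(Y) for every k ∈ ℤ/4ℤ. -/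

import Mathlib

/-- The reversal involution `R_X` on the orientation space `𝕆(X) = (X → ℤˣ) →₀ ℚ`,
induced by pointwise negation of orientations. -/
noncomputable def orientationReversal (X : Type) :
    ((X → ℤˣ) →₀ ℚ) →ₗ[ℚ] ((X → ℤˣ) →₀ ℚ) :=
  Finsupp.lmapDomain ℚ ℚ (fun o => -o)

/-- The `+1`-eigenspace of the reversal involution. -/
noncomputable def posEigenspace (X : Type) : Submodule ℚ ((X → ℤˣ) →₀ ℚ) :=
  LinearMap.ker (orientationReversal X - LinearMap.id)

/-- The `-1`-eigenspace of the reversal involution. -/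
noncomputable def negEigenspace (X : Type) : Submodule ℚ ((X → ℤˣ) →₀ ℚ) :=
  LinearMap.ker (orientationReversal X + LinearMap.id)

/-- The mod-4 grading on `𝕆(X)`: the piece `𝕆_k(X)` is the `+1`-eigenspace of the
reversal if `k ≡ -|X| (mod 4)`, the `-1`-eigenspace if `k ≡ 2 - |X| (mod 4)`, and
zero otherwise. -/
noncomputable def gradedPiece (X : Type) [Fintype X] (k : ZMod 4) :
    Submodule ℚ ((X → ℤˣ) →₀ ℚ) :=
  if k = -(Fintype.card X : ZMod 4) then posEigenspace X
  else if k = 2 - (Fintype.card X : ZMod 4) then negEigenspace X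
  else ⊥

/-- The map `𝕆(X) → 𝕆(Y)` associated to cobordism data `(O, σ, r_X, r_Y)`:
it sends `α` to `∑ o ∈ O, σ(o) ⟨α, r_X(o)⟩ · r_Y(o)`. -/
noncomputable def cobordismMap {X Y O : Type} [Fintype O] (σ : O → ℤˣ)
    (rX : O → X → ℤˣ) (rY : O → Y → ℤˣ) :
    ((X → ℤˣ) →₀ ℚ) →ₗ[ℚ] ((Y → ℤˣ) →₀ ℚ) :=
  ∑ o : O, ((σ o : ℤ) : ℚ) • ((Finsupp.lsingle (rY o)).comp (Finsupp.lapply (rX o)))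

theorem orientationReversal_apply {X : Type} (α : (X → ℤˣ) →₀ ℚ) (x : X → ℤˣ) :
    orientationReversal X α x = α (-x) := by
  have h := Finsupp.mapDomain_apply (f := fun o : X → ℤˣ => -o) neg_injective α (-x)
  simpa [orientationReversal, Finsupp.lmapDomain_apply] using h

theorem cobordismMap_apply {X Y O : Type} [Fintype O] (σ : O → ℤˣ)
    (rX : O → X → ℤˣ) (rY : O → Y → ℤˣ) (α : (X → ℤˣ) →₀ ℚ) :
    cobordismMap σ rX rY α
      = ∑ o, ((σ o : ℤ) : ℚ) • Finsupp.single (rY o) (α (rX o)) := by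
  simp [cobordismMap, LinearMap.sum_apply]

theorem mem_posEigenspace {X : Type} {α : (X → ℤˣ) →₀ ℚ} :
    α ∈ posEigenspace X ↔ orientationReversal X α = α := by
  simp [posEigenspace, sub_eq_zero]

theorem mem_negEigenspace {X : Type} {α : (X → ℤˣ) →₀ ℚ} :
    α ∈ negEigenspace X ↔ orientationReversal X α = -α := by
  simp [negEigenspace, add_eq_zero_iff_eq_neg]

/-- If the sign changes by a constant `ε` under reversal, then the cobordism map commutes with
the reversal involutions up to `ε`. -/
theorem orientationReversal_cobordismMap {X Y O : Type} [Fintype O] (σ : O → ℤˣ)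
    (rX : O → X → ℤˣ) (rY : O → Y → ℤˣ) (bar : O → O) (hbar : Function.Involutive bar)
    (hX : ∀ o, rX (bar o) = -(rX o)) (hY : ∀ o, rY (bar o) = -(rY o))
    (ε : ℤˣ) (hσ : ∀ o, σ (bar o) = ε * σ o) (α : (X → ℤˣ) →₀ ℚ) :
    orientationReversal Y (cobordismMap σ rX rY α)
      = ((ε : ℤ) : ℚ) • cobordismMap σ rX rY (orientationReversal X α) := by
  rw [cobordismMap_apply, cobordismMap_apply, map_sum, Finset.smul_sum,
    ← (Equiv.sum_comp hbar.toPerm)]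
  refine Finset.sum_congr rfl fun o _ => ?_
  simp only [Function.Involutive.coe_toPerm, map_smul, orientationReversal_apply, hσ, hX, hY]
  rw [smul_smul]
  simp only [orientationReversal, Finsupp.lmapDomain_apply, Finsupp.mapDomain_single, neg_neg,
    Units.val_mul, Int.cast_mul]

theorem gradedPiece_neg_card (X : Type) [Fintype X] :
    gradedPiece X (-(Fintype.card X : ZMod 4)) = posEigenspace X := by
  simp [gradedPiece]

theorem gradedPiece_two_sub_card (X : Type) [Fintype X] :
    gradedPiece X (2 - (Fintype.card X : ZMod 4)) = negEigenspace X := by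
  have h : ∀ a : ZMod 4, 2 - a ≠ -a := by decide
  simp [gradedPiece, h]

theorem gradedPiece_eq_bot (X : Type) [Fintype X] {k : ZMod 4}
    (h₀ : k ≠ -(Fintype.card X : ZMod 4)) (h₂ : k ≠ 2 - (Fintype.card X : ZMod 4)) :
    gradedPiece X k = ⊥ := by
  simp [gradedPiece, h₀, h₂]

theorem stmt_6 (X Y O : Type) [Fintype X] [Fintype Y] [Fintype O]
    (σ : O → ℤˣ) (rX : O → X → ℤˣ) (rY : O → Y → ℤˣ)
    (bar : O → O) (hbar : ∀ o, bar (bar o) = o)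
    (hX : ∀ o, rX (bar o) = -(rX o)) (hY : ∀ o, rY (bar o) = -(rY o))
    (χ : ℤ) (hχ : Even (χ + Fintype.card X + Fintype.card Y))
    (hσ : ∀ o, σ (bar o)
      = (-1 : ℤˣ) ^ ((χ - (Fintype.card X : ℤ) + (Fintype.card Y : ℤ)) / 2) * σ o) :
    ∀ k : ZMod 4,
      Submodule.map (cobordismMap σ rX rY) (gradedPiece X k)
        ≤ gradedPiece Y (k + (χ : ZMod 4)) := by
  intro k
  rw [Submodule.map_le_iff_le_comap]
  intro α hα
  rw [Submodule.mem_comap]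
  obtain ⟨m, hm⟩ : Even (χ - (Fintype.card X : ℤ) + (Fintype.card Y : ℤ)) := by grind
  have hdiv : (χ - (Fintype.card X : ℤ) + (Fintype.card Y : ℤ)) / 2 = m := by omega
  rw [hdiv] at hσ
  have hR := orientationReversal_cobordismMap σ rX rY bar hbar hX hY _ hσ α
  have hcast : (χ : ZMod 4) = 2 * (m : ZMod 4) + Fintype.card X - Fintype.card Y := by
    have h := congrArg (Int.cast : ℤ → ZMod 4) hm
    push_cast at h
    linear_combination h
  have h4 : (4 : ZMod 4) = 0 := rfl
  by_cases hk₀ : k = -(Fintype.card X : ZMod 4)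
  · rw [hk₀, gradedPiece_neg_card, mem_posEigenspace] at hα
    rcases Int.even_or_odd' m with ⟨n, rfl | rfl⟩
    · have hdeg : k + (χ : ZMod 4) = -(Fintype.card Y : ZMod 4) := by
        rw [hk₀, hcast]; push_cast; linear_combination (n : ZMod 4) * h4
      rw [hdeg, gradedPiece_neg_card, mem_posEigenspace, hR, hα]
      simp [zpow_mul]
    · have hdeg : k + (χ : ZMod 4) = 2 - (Fintype.card Y : ZMod 4) := by
        rw [hk₀, hcast]; push_cast; linear_combination (n : ZMod 4) * h4
      rw [hdeg, gradedPiece_two_sub_card, mem_negEigenspace, hR, hα]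
      simp [zpow_add, zpow_mul]
  by_cases hk₂ : k = 2 - (Fintype.card X : ZMod 4)
  · rw [hk₂, gradedPiece_two_sub_card, mem_negEigenspace] at hα
    rcases Int.even_or_odd' m with ⟨n, rfl | rfl⟩
    · have hdeg : k + (χ : ZMod 4) = 2 - (Fintype.card Y : ZMod 4) := by
        rw [hk₂, hcast]; push_cast; linear_combination (n : ZMod 4) * h4
      rw [hdeg, gradedPiece_two_sub_card, mem_negEigenspace, hR, hα]
      simp [zpow_mul]
    · have hdeg : k + (χ : ZMod 4) = -(Fintype.card Y : ZMod 4) := by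
        rw [hk₂, hcast]; push_cast; linear_combination ((n : ZMod 4) + 1) * h4
      rw [hdeg, gradedPiece_neg_card, mem_posEigenspace, hR, hα]
      simp [zpow_add, zpow_mul]
  · rw [gradedPiece_eq_bot X hk₀ hk₂, Submodule.mem_bot] at hα
    simp [hα]
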